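/- Define β(n) by ∑_{n≥0} β(n) q^n = (q^2,q^3;q^5)_∞^2 (-q^2,-q^8;q^{10})_∞ / ((q,q^4;q^5)_∞^2 (-q^4,-q^6;q^{10})_∞). Then β(10n+3)=0 and β(10n+7)=0 for all n≥0. -/

import Mathlib

/-- Euler's product E(q) = ∏_{k≥0} (1 - q^{k+1}). -/
noncomputable def E (q : ℂ) : ℂ := ∏' k : ℕ, (1 - q ^ (k + 1))

/-- q-Pochhammer infinite product (a;q)_∞ = ∏_{k≥0} (1 - a q^k). -/
noncomputable def qp (a q : ℂ) : ℂ := ∏' k : ℕ, (1 - a * q ^ k)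

/-- Rogers–Ramanujan function G(q) = 1/((q,q^4;q^5)_∞). -/
noncomputable def G (q : ℂ) : ℂ := 1 / (qp q (q ^ 5) * qp (q ^ 4) (q ^ 5))

/-- Rogers–Ramanujan function H(q) = 1/((q^2,q^3;q^5)_∞). -/
noncomputable def H (q : ℂ) : ℂ := 1 / (qp (q ^ 2) (q ^ 5) * qp (q ^ 3) (q ^ 5))

/-- Rogers–Ramanujan continued fraction product R(q). -/
noncomputable def R (q : ℂ) : ℂ :=
  (qp q (q ^ 5) * qp (q ^ 4) (q ^ 5)) / (qp (q ^ 2) (q ^ 5) * qp (q ^ 3) (q ^ 5))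

open Filter Topology

lemma summable_norm_mul_pow (a : ℂ) {q : ℂ} (hq : ‖q‖ < 1) :
    Summable fun k : ℕ => ‖-(a * q ^ k)‖ := by
  simpa only [norm_neg, norm_mul, norm_pow] using
    (summable_geometric_of_lt_one (norm_nonneg q) hq).mul_left ‖a‖

lemma multipliable_qp (a : ℂ) {q : ℂ} (hq : ‖q‖ < 1) :
    Multipliable fun k : ℕ => 1 - a * q ^ k := by
  simpa only [sub_eq_add_neg] using
    multipliable_one_add_of_summable (summable_norm_mul_pow a hq)

lemma tendsto_prod_qp (a : ℂ) {q : ℂ} (hq : ‖q‖ < 1) :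
    Tendsto (fun n : ℕ => ∏ k ∈ Finset.range n, (1 - a * q ^ k)) atTop (𝓝 (qp a q)) :=
  (multipliable_qp a hq).tendsto_prod_tprod_nat

lemma one_sub_mul_pow_ne_zero {a q : ℂ} (ha : ‖a‖ < 1) (hq : ‖q‖ < 1) (k : ℕ) :
    1 - a * q ^ k ≠ 0 := by
  intro h
  have h1 : ‖a * q ^ k‖ < 1 := by
    rw [norm_mul, norm_pow]
    exact mul_lt_one_of_nonneg_of_lt_one_left (norm_nonneg _) ha
      (pow_le_one₀ (norm_nonneg _) hq.le)
  rw [← sub_eq_zero.mp h, norm_one] at h1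
  exact lt_irrefl _ h1

lemma qp_ne_zero {a q : ℂ} (ha : ‖a‖ < 1) (hq : ‖q‖ < 1) : qp a q ≠ 0 := by
  have := tprod_one_add_ne_zero_of_summable (f := fun k : ℕ => -(a * q ^ k))
    (fun k => by simpa only [← sub_eq_add_neg] using one_sub_mul_pow_ne_zero ha hq k)
    (summable_norm_mul_pow a hq)
  simpa only [qp, sub_eq_add_neg] using this

/-- Splitting a `q`-Pochhammer product by the residue of the index modulo `m`. -/
lemma qp_eq_prod_qp (a : ℂ) {q : ℂ} (hq : ‖q‖ < 1) {m : ℕ} (hm : m ≠ 0) :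
    qp a q = ∏ i ∈ Finset.range m, qp (a * q ^ i) (q ^ m) := by
  have hqm : ‖q ^ m‖ < 1 := by
    rw [norm_pow]; exact pow_lt_one₀ (norm_nonneg _) hq hm
  have h1 : Tendsto (fun n : ℕ => ∏ k ∈ Finset.range (m * n), (1 - a * q ^ k)) atTop
      (𝓝 (qp a q)) :=
    (tendsto_prod_qp a hq).comp (tendsto_id.const_mul_atTop' (Nat.pos_of_ne_zero hm))
  have h2 : Tendsto (fun n : ℕ => ∏ i ∈ Finset.range m, ∏ k ∈ Finset.range n,
      (1 - a * q ^ i * (q ^ m) ^ k)) atTop (𝓝 (∏ i ∈ Finset.range m, qp (a * q ^ i) (q ^ m))) :=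
    tendsto_finsetProd _ fun i _ => tendsto_prod_qp (a * q ^ i) hqm
  refine tendsto_nhds_unique h1 (h2.congr fun n => ?_)
  induction n with
  | zero => simp
  | succ n ih =>
    rw [mul_add, mul_one, Finset.prod_range_add, ← ih, ← Finset.prod_mul_distrib]
    refine Finset.prod_congr rfl fun i _ => ?_
    rw [Finset.prod_range_succ, ← pow_mul, mul_assoc a, ← pow_add, add_comm i]

lemma qp_mul_qp_neg (a : ℂ) {q : ℂ} (hq : ‖q‖ < 1) :
    qp a q * qp (-a) q = qp (a ^ 2) (q ^ 2) := by
  rw [qp, qp, ← (multipliable_qp a hq).tprod_mul (multipliable_qp (-a) hq), qp]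
  exact tprod_congr fun k => by ring

/-- The reciprocal of `(q;q)_m`, extended by zero to negative `m`. -/
noncomputable def invQFactorial (q : ℂ) (m : ℤ) : ℂ :=
  if 0 ≤ m then (∏ k ∈ Finset.range m.toNat, (1 - q * q ^ k))⁻¹ else 0

lemma one_sub_zpow_mul_invQFactorial {q : ℂ} (hq : ‖q‖ < 1) (m : ℤ) :
    (1 - q ^ m) * invQFactorial q m = invQFactorial q (m - 1) := by
  rcases lt_trichotomy m 0 with h | rfl | h
  · simp [invQFactorial, h.not_ge, show ¬ (1 ≤ m) by omega]
  · simp [invQFactorial]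
  · obtain ⟨n, rfl⟩ : ∃ n : ℕ, m = n + 1 := ⟨(m - 1).toNat, by omega⟩
    have h1 : (1 : ℂ) - q * q ^ n ≠ 0 := one_sub_mul_pow_ne_zero hq hq n
    have h2 : ((n : ℤ) + 1).toNat = n + 1 := by omega
    rw [invQFactorial, invQFactorial, if_pos (by omega), if_pos (by omega), add_sub_cancel_right,
      Int.toNat_natCast, h2, Finset.prod_range_succ, mul_inv, mul_left_comm]
    have h3 : q ^ ((n : ℤ) + 1) = q * q ^ n := by
      rw [← pow_succ', ← zpow_natCast]; norm_cast
    rw [h3, mul_inv_cancel₀ h1, mul_one]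

lemma tendsto_invQFactorial {q : ℂ} (hq : ‖q‖ < 1) :
    Tendsto (invQFactorial q) atTop (𝓝 (qp q q)⁻¹) := by
  have h := ((tendsto_prod_qp q hq).inv₀ (qp_ne_zero hq hq)).comp
    (tendsto_atTop.mpr fun b => (eventually_ge_atTop (b : ℤ)).mono fun m hm => by omega :
      Tendsto Int.toNat atTop atTop)
  refine h.congr' ?_
  filter_upwards [eventually_ge_atTop 0] with m hm
  simp [invQFactorial, hm]

lemma exists_norm_invQFactorial_le {q : ℂ} (hq : ‖q‖ < 1) :
    ∃ C, ∀ m, ‖invQFactorial q m‖ ≤ C := by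
  obtain ⟨C, hC⟩ := ((tendsto_prod_qp q hq).inv₀ (qp_ne_zero hq hq)).norm.bddAbove_range
  refine ⟨max C 0, fun m => ?_⟩
  unfold invQFactorial
  split_ifs
  · exact le_max_of_le_left (hC ⟨m.toNat, rfl⟩)
  · simp

/-- The coefficient of `x ^ n` in the finite Jacobi triple product
`(x;q)_N (q/x;q)_N`. -/
noncomputable def tripleCoeff (q : ℂ) (N : ℕ) (n : ℤ) : ℂ :=
  (∏ k ∈ Finset.range (2 * N), (1 - q * q ^ k)) *
    (invQFactorial q (N + n) * invQFactorial q (N - n)) * ((-1) ^ n * q ^ (n * (n - 1) / 2))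

lemma triangular_add_one (n : ℤ) : (n + 1) * (n + 1 - 1) / 2 = n * (n - 1) / 2 + n := by
  rw [show (n + 1) * (n + 1 - 1) = n * (n - 1) + n * 2 by ring, Int.add_mul_ediv_right _ _ two_ne_zero]

lemma tripleCoeff_succ {q : ℂ} (hq0 : q ≠ 0) (hq : ‖q‖ < 1) (N : ℕ) (n : ℤ) :
    tripleCoeff q (N + 1) n = (1 + q ^ (2 * N + 1)) * tripleCoeff q N n
      - q ^ N * tripleCoeff q N (n - 1) - q ^ (N + 1) * tripleCoeff q N (n + 1) := by
  set V := invQFactorial q (N + 1 + n) with hV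
  set W := invQFactorial q (N + 1 - n) with hW
  have hv1 : invQFactorial q (N + n) = (1 - q ^ (N + 1 + n : ℤ)) * V := by
    rw [hV, one_sub_zpow_mul_invQFactorial hq]; congr 1; ring
  have hv2 : invQFactorial q (N + (n - 1)) = (1 - q ^ (N + n : ℤ)) * ((1 - q ^ (N + 1 + n : ℤ)) * V) := by
    rw [← hv1, one_sub_zpow_mul_invQFactorial hq]; congr 1; ring
  have hw1 : invQFactorial q (N - n) = (1 - q ^ (N + 1 - n : ℤ)) * W := by
    rw [hW, one_sub_zpow_mul_invQFactorial hq]; congr 1; ring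
  have hw2 : invQFactorial q (N - (n + 1)) = (1 - q ^ (N - n : ℤ)) * ((1 - q ^ (N + 1 - n : ℤ)) * W) := by
    rw [← hw1, one_sub_zpow_mul_invQFactorial hq]; congr 1; ring
  have ht : (n * (n - 1)) / 2 = (n - 1) * (n - 1 - 1) / 2 + (n - 1) := by
    simpa using triangular_add_one (n - 1)
  have e1 : (N : ℤ) + (n + 1) = N + 1 + n := by ring
  have e2 : (N : ℤ) - (n - 1) = N + 1 - n := by ring
  have m1 : (-1 : ℂ) ^ (n - 1) = - (-1) ^ n := by
    rw [zpow_sub₀ (by norm_num), zpow_one, div_neg, div_one]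
  have m2 : (-1 : ℂ) ^ (n + 1) = - (-1) ^ n := by
    rw [zpow_add₀ (by norm_num)]; simp
  simp only [tripleCoeff, Nat.cast_add, Nat.cast_one, e1, e2, hv1, hv2, hw1, hw2, ← hV, ← hW,
    triangular_add_one, m1, m2]
  rw [ht, show 2 * (N + 1) = 2 * N + 1 + 1 by ring, Finset.prod_range_succ, Finset.prod_range_succ]
  simp only [zpow_add₀ hq0, zpow_sub₀ hq0, zpow_natCast, zpow_one]
  have hx : q ^ n ≠ 0 := zpow_ne_zero _ hq0
  generalize q ^ n = u at *
  generalize q ^ ((n - 1) * (n - 1 - 1) / 2) = w at *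
  field_simp
  ring

lemma hasSum_tripleCoeff {q x : ℂ} (hq0 : q ≠ 0) (hq : ‖q‖ < 1) (hx : x ≠ 0) (N : ℕ) :
    HasSum (fun n : ℤ => tripleCoeff q N n * x ^ n)
      ((∏ k ∈ Finset.range N, (1 - x * q ^ k)) * ∏ k ∈ Finset.range N, (1 - q / x * q ^ k)) := by
  induction N with
  | zero =>
    have h := hasSum_single (f := fun n : ℤ => tripleCoeff q 0 n * x ^ n) 0 (fun n hn => by
      rcases lt_or_gt_of_ne hn with h | h <;>
      simp [tripleCoeff, invQFactorial, h.not_ge])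
    convert h using 1
    simp [tripleCoeff, invQFactorial]
  | succ N ih =>
    have h1 := (Equiv.subRight (1 : ℤ)).hasSum_iff.mpr ih
    have h2 := (Equiv.addRight (1 : ℤ)).hasSum_iff.mpr ih
    have h := ((ih.mul_left (1 + q ^ (2 * N + 1))).sub (h1.mul_left (q ^ N * x))).sub
      (h2.mul_left (q ^ (N + 1) * x⁻¹))
    rw [Finset.prod_range_succ, Finset.prod_range_succ]
    convert h using 1
    · rfl
    · ext n
      simp only [Function.comp, Equiv.subRight_apply, Equiv.coe_addRight]
      rw [tripleCoeff_succ hq0 hq, zpow_sub₀ hx, zpow_add₀ hx, zpow_one]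
      field_simp
    · field_simp
      ring

/-- The `n`-th term of the theta series `∑ (-1)^n q^(n(n-1)/2) x^n`. -/
noncomputable def thetaTerm (q x : ℂ) (n : ℤ) : ℂ := (-1) ^ n * q ^ (n * (n - 1) / 2) * x ^ n

lemma thetaTerm_add_one {q x : ℂ} (hq0 : q ≠ 0) (hx : x ≠ 0) (n : ℤ) :
    thetaTerm q x (n + 1) = -(q ^ n * x) * thetaTerm q x n := by
  rw [thetaTerm, thetaTerm, triangular_add_one, zpow_add₀ hq0, zpow_add₀ hx,
    zpow_add₀ (by norm_num : (-1 : ℂ) ≠ 0), zpow_one, zpow_one]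
  ring

lemma thetaTerm_ne_zero {q x : ℂ} (hq0 : q ≠ 0) (hx : x ≠ 0) (n : ℤ) : thetaTerm q x n ≠ 0 :=
  mul_ne_zero (mul_ne_zero (zpow_ne_zero _ (by norm_num)) (zpow_ne_zero _ hq0)) (zpow_ne_zero _ hx)

lemma summable_thetaTerm_nat {q x : ℂ} (hq0 : q ≠ 0) (hq : ‖q‖ < 1) (hx : x ≠ 0) :
    Summable fun n : ℕ => thetaTerm q x n := by
  refine summable_of_ratio_test_tendsto_lt_one zero_lt_one
    (Eventually.of_forall fun n => thetaTerm_ne_zero hq0 hx n) ?_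
  have h : Tendsto (fun n : ℕ => ‖q‖ ^ n * ‖x‖) atTop (𝓝 0) := by
    simpa using (tendsto_pow_atTop_nhds_zero_of_lt_one (norm_nonneg q) hq).mul_const ‖x‖
  refine h.congr fun n => ?_
  rw [Nat.cast_add, Nat.cast_one, thetaTerm_add_one hq0 hx, norm_mul, mul_div_assoc, div_self
    (norm_ne_zero_iff.mpr (thetaTerm_ne_zero hq0 hx n))]
  simp

lemma thetaTerm_neg (q x : ℂ) (hq0 : q ≠ 0) (n : ℤ) :
    thetaTerm q x (-n) = thetaTerm q (q / x) n := by
  have h : -n * (-n - 1) / 2 = n * (n - 1) / 2 + n := by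
    rw [← triangular_add_one]; congr 1; ring
  have h1 : (-1 : ℂ) ^ (-n) = (-1) ^ n := by
    rw [zpow_neg, ← inv_zpow]; norm_num
  rw [thetaTerm, thetaTerm, h, h1, zpow_add₀ hq0, div_zpow, zpow_neg]
  ring

lemma summable_thetaTerm {q x : ℂ} (hq0 : q ≠ 0) (hq : ‖q‖ < 1) (hx : x ≠ 0) :
    Summable (thetaTerm q x) := by
  refine Summable.of_nat_of_neg (summable_thetaTerm_nat hq0 hq hx) ?_
  simp only [thetaTerm_neg q x hq0]
  exact summable_thetaTerm_nat hq0 hq (div_ne_zero hq0 hx)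

/-- The theta function `j(x;q) = (x;q)_∞ (q/x;q)_∞ (q;q)_∞`. -/
noncomputable def theta (x q : ℂ) : ℂ := qp x q * qp (q / x) q * qp q q

/-- The Jacobi triple product identity. -/
theorem theta_eq_tsum {q x : ℂ} (hq0 : q ≠ 0) (hq : ‖q‖ < 1) (hx : x ≠ 0) :
    theta x q = ∑' n, thetaTerm q x n := by
  have hE := qp_ne_zero hq hq
  have hpart := tendsto_prod_qp q hq
  obtain ⟨C, hC⟩ := exists_norm_invQFactorial_le hq
  obtain ⟨D, hD⟩ := hpart.norm.bddAbove_range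
  have hC0 : 0 ≤ C := (norm_nonneg _).trans (hC 0)
  have hcast : Tendsto (fun N : ℕ => (N : ℤ)) atTop atTop := tendsto_natCast_atTop_atTop
  have hlim : Tendsto (fun N : ℕ => ∑' n : ℤ, tripleCoeff q N n * x ^ n) atTop
      (𝓝 (∑' n : ℤ, (qp q q)⁻¹ * thetaTerm q x n)) := by
    refine tendsto_tsum_of_dominated_convergence
      (bound := fun n => D * (C * C) * ‖thetaTerm q x n‖)
      ((summable_thetaTerm hq0 hq hx).norm.mul_left _) (fun n => ?_)
      (Eventually.of_forall fun N n => ?_)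
    · have h1 := (tendsto_invQFactorial hq).comp (tendsto_atTop_add_const_right _ n hcast)
      have h2 := (tendsto_invQFactorial hq).comp (tendsto_atTop_add_const_right _ (-n) hcast)
      have h3 := hpart.comp ((tendsto_id (α := ℕ)).const_mul_atTop' two_pos)
      have h := (h3.mul (h1.mul h2)).mul_const (thetaTerm q x n)
      rw [mul_inv_cancel_left₀ hE] at h
      refine h.congr fun N => ?_
      simp only [Function.comp, tripleCoeff, thetaTerm, id, sub_eq_add_neg]
      ring
    · rw [tripleCoeff, mul_assoc _ _ (x ^ n), ← thetaTerm, norm_mul, norm_mul, norm_mul]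
      have := hD ⟨2 * N, rfl⟩
      gcongr
      · exact (norm_nonneg _).trans this
      · exact hC _
      · exact hC _
  have hprod := (tendsto_prod_qp x hq).mul (tendsto_prod_qp (q / x) hq)
  have h := tendsto_nhds_unique hprod
    (hlim.congr fun N => (hasSum_tripleCoeff hq0 hq hx N).tsum_eq)
  rw [theta, h, tsum_mul_left, mul_comm, mul_inv_cancel_left₀ hE]

lemma triangular_add (s t : ℤ) :
    (s + t) * (s + t - 1) / 2 = s * (s - 1) / 2 + t * (t - 1) / 2 + s * t := by
  have hs := Int.two_mul_ediv_two_of_even (Int.even_mul_pred_self s)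
  have ht := Int.two_mul_ediv_two_of_even (Int.even_mul_pred_self t)
  have hst := Int.two_mul_ediv_two_of_even (Int.even_mul_pred_self (s + t))
  nlinarith

lemma triangular_sub (s t : ℤ) :
    (s - t) * (s - t - 1) / 2 = s * (s - 1) / 2 + t * (t - 1) / 2 + t - s * t := by
  have h := triangular_add (s - t) t
  rw [sub_add_cancel] at h
  have ht := Int.two_mul_ediv_two_of_even (Int.even_mul_pred_self t)
  linear_combination -h - ht

lemma neg_one_zpow_mul_self (n : ℤ) : (-1 : ℂ) ^ n * (-1) ^ n = 1 := by
  rw [← mul_zpow]; norm_num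

lemma neg_one_zpow_ne_zero (n : ℤ) : (-1 : ℂ) ^ n ≠ 0 := zpow_ne_zero _ (by norm_num)

lemma thetaTerm_neg_arg (q x : ℂ) (n : ℤ) :
    thetaTerm q (-x) n = (-1) ^ n * thetaTerm q x n := by
  rw [thetaTerm, thetaTerm, neg_eq_neg_one_mul x, mul_zpow]; ring

lemma thetaTerm_add_mul_thetaTerm_sub {q x y : ℂ} (hq0 : q ≠ 0) (hx : x ≠ 0) (hy : y ≠ 0)
    (s t : ℤ) :
    thetaTerm q x (s + t) * thetaTerm q y (s - t) =
      (-1) ^ s * (-1) ^ t * (thetaTerm (q ^ 2) (x * y) s * thetaTerm (q ^ 2) (q * x / y) t) := by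
  have h1 (n : ℤ) : (q ^ 2) ^ n = q ^ n * q ^ n := by rw [pow_two, mul_zpow]
  have hm : (-1 : ℂ) ≠ 0 := by norm_num
  have hxt : x ^ t ≠ 0 := zpow_ne_zero _ hx
  have hyt : y ^ t ≠ 0 := zpow_ne_zero _ hy
  have hst : q ^ (s * t) ≠ 0 := zpow_ne_zero _ hq0
  have ht := neg_one_zpow_ne_zero t
  have hs := neg_one_zpow_mul_self s
  have ht' := neg_one_zpow_mul_self t
  simp only [thetaTerm, triangular_add, triangular_sub, h1, mul_zpow, div_zpow,
    zpow_add₀ hq0, zpow_sub₀ hq0, zpow_add₀ hx, zpow_sub₀ hy, zpow_add₀ hm, zpow_sub₀ hm]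
  generalize (-1 : ℂ) ^ s = e at *
  generalize (-1 : ℂ) ^ t = f at *
  field_simp
  linear_combination -e ^ 2 * ht'

/-- The `(m, n)` terms with `m ≡ n` modulo `2` of a double series. -/
lemma tsum_even_sublattice {f : ℤ × ℤ → ℂ} (hf : ∀ m n, Odd (m + n) → f (m, n) = 0) :
    ∑' z, f z = ∑' z : ℤ × ℤ, f (z.1 + z.2, z.1 - z.2) := by
  have hinj : Function.Injective fun z : ℤ × ℤ => (z.1 + z.2, z.1 - z.2) := by
    rintro ⟨a, b⟩ ⟨c, d⟩ h
    simp only [Prod.mk.injEq] at h ⊢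
    omega
  refine (hinj.tsum_eq ?_).symm
  rintro ⟨m, n⟩ h
  have h1 : Even (m + n) := by
    by_contra h2
    exact h (hf m n (Int.not_even_iff_odd.mp h2))
  obtain ⟨k, hk⟩ := h1
  refine ⟨(k, m - k), ?_⟩
  simp only [Prod.mk.injEq]
  omega

lemma tsum_odd_sublattice {f : ℤ × ℤ → ℂ} (hf : ∀ m n, Even (m + n) → f (m, n) = 0) :
    ∑' z, f z = ∑' z : ℤ × ℤ, f (z.1 + z.2 + 1, z.1 - z.2) := by
  rw [← ((Equiv.addRight (1 : ℤ)).prodCongr (Equiv.refl ℤ)).tsum_eq f]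
  exact tsum_even_sublattice fun m n h => hf _ _ (by
    simp only [Equiv.coe_addRight, Equiv.refl_apply]
    rw [add_right_comm]
    exact h.add_one)

lemma theta_mul_theta {q x y : ℂ} (hq0 : q ≠ 0) (hq : ‖q‖ < 1) (hx : x ≠ 0) (hy : y ≠ 0) :
    HasSum (fun z : ℤ × ℤ => thetaTerm q x z.1 * thetaTerm q y z.2) (theta x q * theta y q) := by
  have h1 := (summable_thetaTerm hq0 hq hx).norm
  have h2 := (summable_thetaTerm hq0 hq hy).norm
  rw [theta_eq_tsum hq0 hq hx, theta_eq_tsum hq0 hq hy, tsum_mul_tsum_of_summable_norm h1 h2]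
  exact (summable_mul_of_summable_norm h1 h2).hasSum

lemma norm_sq_lt_one {q : ℂ} (hq : ‖q‖ < 1) : ‖q ^ 2‖ < 1 := by
  rw [norm_pow]; exact pow_lt_one₀ (norm_nonneg _) hq two_ne_zero

theorem theta_mul_theta_neg_add {q x y : ℂ} (hq0 : q ≠ 0) (hq : ‖q‖ < 1) (hx : x ≠ 0)
    (hy : y ≠ 0) :
    theta x q * theta (-y) q + theta (-x) q * theta y q =
      2 * (theta (x * y) (q ^ 2) * theta (q * x / y) (q ^ 2)) := by
  have h := ((theta_mul_theta hq0 hq hx (neg_ne_zero.mpr hy)).add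
    (theta_mul_theta hq0 hq (neg_ne_zero.mpr hx) hy)).tsum_eq
  have h' := ((theta_mul_theta (pow_ne_zero 2 hq0) (norm_sq_lt_one hq) (mul_ne_zero hx hy)
    (div_ne_zero (mul_ne_zero hq0 hx) hy)).mul_left 2).tsum_eq
  rw [← h, ← h', tsum_even_sublattice]
  · refine tsum_congr fun ⟨s, t⟩ => ?_
    have hs := neg_one_zpow_mul_self s
    have ht := neg_one_zpow_mul_self t
    have hm : (-1 : ℂ) ≠ 0 := by norm_num
    have ht0 := neg_one_zpow_ne_zero t
    have e1 : (-1 : ℂ) ^ (s - t) = (-1) ^ s * (-1) ^ t := by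
      rw [zpow_sub₀ hm, div_eq_iff ht0, mul_assoc, ht, mul_one]
    have key := thetaTerm_add_mul_thetaTerm_sub hq0 hx hy s t
    simp only [thetaTerm_neg_arg, e1, zpow_add₀ hm]
    linear_combination 2 * (-1) ^ s * (-1) ^ t * key + 2 * (thetaTerm (q ^ 2) (x * y) s *
      thetaTerm (q ^ 2) (q * x / y) t) * ((-1) ^ t * (-1) ^ t * hs + ht)
  · intro m n hmn
    simp only [thetaTerm_neg_arg]
    have h1 : (-1 : ℂ) ^ n = -(-1) ^ m := by
      have := hmn.neg_one_zpow (α := ℂ)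
      rw [zpow_add₀ (by norm_num)] at this
      linear_combination (-1) ^ m * this - (-1) ^ n * neg_one_zpow_mul_self m
    rw [h1]; ring

theorem theta_mul_theta_neg_sub {q x y : ℂ} (hq0 : q ≠ 0) (hq : ‖q‖ < 1) (hx : x ≠ 0)
    (hy : y ≠ 0) :
    theta x q * theta (-y) q - theta (-x) q * theta y q =
      -2 * x * (theta (q * x * y) (q ^ 2) * theta (q ^ 2 * x / y) (q ^ 2)) := by
  have h := ((theta_mul_theta hq0 hq hx (neg_ne_zero.mpr hy)).sub
    (theta_mul_theta hq0 hq (neg_ne_zero.mpr hx) hy)).tsum_eq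
  have h' := ((theta_mul_theta (pow_ne_zero 2 hq0) (norm_sq_lt_one hq)
    (mul_ne_zero (mul_ne_zero hq0 hx) hy)
    (div_ne_zero (mul_ne_zero (pow_ne_zero 2 hq0) hx) hy)).mul_left (-2 * x)).tsum_eq
  rw [← h, ← h', tsum_odd_sublattice]
  · refine tsum_congr fun ⟨s, t⟩ => ?_
    have hs := neg_one_zpow_mul_self s
    have ht := neg_one_zpow_mul_self t
    have hm : (-1 : ℂ) ≠ 0 := by norm_num
    have ht0 := neg_one_zpow_ne_zero t
    have e1 : (-1 : ℂ) ^ (s - t) = (-1) ^ s * (-1) ^ t := by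
      rw [zpow_sub₀ hm, div_eq_iff ht0, mul_assoc, ht, mul_one]
    have key := thetaTerm_add_mul_thetaTerm_sub hq0 hx hy s t
    have e2 : thetaTerm (q ^ 2) (q * x * y) s = q ^ s * thetaTerm (q ^ 2) (x * y) s := by
      rw [thetaTerm, thetaTerm, mul_assoc q, mul_zpow q]; ring
    have e3 : thetaTerm (q ^ 2) (q ^ 2 * x / y) t = q ^ t * thetaTerm (q ^ 2) (q * x / y) t := by
      rw [thetaTerm, thetaTerm, show q ^ 2 * x / y = q * (q * x / y) by ring, mul_zpow q]; ring
    simp only [thetaTerm_neg_arg, e1, e2, e3, zpow_add₀ hm, zpow_one, thetaTerm_add_one hq0 hx,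
      zpow_add₀ hq0]
    linear_combination (-2) * x * q ^ s * q ^ t * ((-1) ^ s * (-1) ^ t * key +
      (thetaTerm (q ^ 2) (x * y) s *
      thetaTerm (q ^ 2) (q * x / y) t) * ((-1) ^ t * (-1) ^ t * hs + ht))
  · intro m n hmn
    simp only [thetaTerm_neg_arg]
    have h1 : (-1 : ℂ) ^ n = (-1) ^ m := by
      have := hmn.neg_one_zpow (α := ℂ)
      rw [zpow_add₀ (by norm_num)] at this
      linear_combination (-1) ^ m * this - (-1) ^ n * neg_one_zpow_mul_self m
    rw [h1]; ring

theorem theta_sq_mul_theta_neg_sq_sub {q x y : ℂ} (hq0 : q ≠ 0) (hq : ‖q‖ < 1) (hx : x ≠ 0)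
    (hy : y ≠ 0) :
    (theta x q * theta (-y) q) ^ 2 - (theta (-x) q * theta y q) ^ 2 =
      -4 * x * (theta (x * y) (q ^ 2) * theta (q * x / y) (q ^ 2) *
        theta (q * x * y) (q ^ 2) * theta (q ^ 2 * x / y) (q ^ 2)) := by
  rw [sq_sub_sq, theta_mul_theta_neg_add hq0 hq hx hy, theta_mul_theta_neg_sub hq0 hq hx hy]
  ring

/-- The product `1/ν(q²)` generating `β`. -/
noncomputable def invNu (q : ℂ) : ℂ :=
  (qp (q ^ 2) (q ^ 5) * qp (q ^ 3) (q ^ 5)) ^ 2 *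
      (qp (-(q ^ 2)) (q ^ 10) * qp (-(q ^ 8)) (q ^ 10)) /
    ((qp q (q ^ 5) * qp (q ^ 4) (q ^ 5)) ^ 2 * (qp (-(q ^ 4)) (q ^ 10) * qp (-(q ^ 6)) (q ^ 10)))

lemma norm_pow_lt_one {q : ℂ} (hq : ‖q‖ < 1) {n : ℕ} (hn : n ≠ 0) : ‖q ^ n‖ < 1 := by
  rw [norm_pow]; exact pow_lt_one₀ (norm_nonneg _) hq hn

lemma qp_eq_mul_qp (a : ℂ) {q : ℂ} (hq : ‖q‖ < 1) :
    qp a q = qp a (q ^ 2) * qp (a * q) (q ^ 2) := by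
  simpa [Finset.prod_range_succ] using qp_eq_prod_qp a hq two_ne_zero

lemma qp_pow_mul_qp_neg_pow {q : ℂ} (hq : ‖q‖ < 1) (i : ℕ) :
    qp (q ^ i) (q ^ 10) * qp (-q ^ i) (q ^ 10) = qp (q ^ (2 * i)) (q ^ 20) := by
  rw [qp_mul_qp_neg _ (norm_pow_lt_one hq (by norm_num)), ← pow_mul, ← pow_mul, mul_comm i]

lemma qp_pow_ten {q : ℂ} (hq : ‖q‖ < 1) (i : ℕ) :
    qp (q ^ i) (q ^ 10) = qp (q ^ i) (q ^ 20) * qp (q ^ (i + 10)) (q ^ 20) := by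
  rw [qp_eq_mul_qp _ (norm_pow_lt_one hq (by norm_num)), ← pow_mul, ← pow_add]

lemma qp_pow_five {q : ℂ} (hq : ‖q‖ < 1) (i : ℕ) :
    qp (q ^ i) (q ^ 5) = qp (q ^ i) (q ^ 10) * qp (q ^ (i + 5)) (q ^ 10) := by
  rw [qp_eq_mul_qp _ (norm_pow_lt_one hq (by norm_num)), ← pow_mul, ← pow_add]

lemma theta_pow {q : ℂ} (hq0 : q ≠ 0) {i j m : ℕ} (h : i + j = m) :
    theta (q ^ i) (q ^ m) = qp (q ^ i) (q ^ m) * qp (q ^ j) (q ^ m) * qp (q ^ m) (q ^ m) := by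
  rw [theta, ← h, pow_add, mul_div_cancel_left₀ _ (pow_ne_zero i hq0)]

lemma theta_neg_pow {q : ℂ} (hq0 : q ≠ 0) {i j m : ℕ} (h : i + j = m) :
    theta (-q ^ i) (q ^ m) = qp (-q ^ i) (q ^ m) * qp (-q ^ j) (q ^ m) * qp (q ^ m) (q ^ m) := by
  rw [theta, ← h, pow_add, div_neg, mul_div_cancel_left₀ _ (pow_ne_zero i hq0)]

lemma qp_pow_four_eq_prod {q : ℂ} (hq : ‖q‖ < 1) :
    qp (q ^ 4) (q ^ 4) = qp (q ^ 4) (q ^ 20) * qp (q ^ 8) (q ^ 20) * qp (q ^ 12) (q ^ 20) *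
      qp (q ^ 16) (q ^ 20) * qp (q ^ 20) (q ^ 20) := by
  rw [qp_eq_prod_qp _ (norm_pow_lt_one hq (by norm_num)) (by norm_num : 5 ≠ 0)]
  simp [Finset.prod_range_succ, ← pow_mul, ← pow_add]

lemma qp_pow_four_eq_theta {q : ℂ} (hq0 : q ≠ 0) (hq : ‖q‖ < 1) :
    qp (q ^ 4) (q ^ 4) = theta (q ^ 4) (q ^ 12) := by
  rw [qp_eq_prod_qp _ (norm_pow_lt_one hq (by norm_num)) (by norm_num : 3 ≠ 0),
    theta_pow (j := 8) hq0 (by norm_num)]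
  simp [Finset.prod_range_succ, ← pow_mul, ← pow_add]

/-- The odd part of `1/ν(q²)`. -/
theorem invNu_sub_invNu_neg {q : ℂ} (hq0 : q ≠ 0) (hq : ‖q‖ < 1) :
    invNu q - invNu (-q) = 4 * q * qp (q ^ 4) (q ^ 4) *
      (qp (q ^ 20) (q ^ 20) ^ 3 / qp (q ^ 10) (q ^ 10) ^ 4) := by
  have hne {m i : ℕ} (hm : m ≠ 0) (hi : i ≠ 0) : qp (q ^ i) (q ^ m) ≠ 0 :=
    qp_ne_zero (norm_pow_lt_one hq hi) (norm_pow_lt_one hq hm)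
  have hne' {m i : ℕ} (hm : m ≠ 0) (hi : i ≠ 0) : qp (-q ^ i) (q ^ m) ≠ 0 :=
    qp_ne_zero (by rw [norm_neg]; exact norm_pow_lt_one hq hi) (norm_pow_lt_one hq hm)
  have hpos : invNu q = (qp (q ^ 2) (q ^ 10) * qp (q ^ 7) (q ^ 10) *
        (qp (q ^ 3) (q ^ 10) * qp (q ^ 8) (q ^ 10))) ^ 2 *
        (qp (-q ^ 2) (q ^ 10) * qp (-q ^ 8) (q ^ 10)) /
      ((qp (q ^ 1) (q ^ 10) * qp (q ^ 6) (q ^ 10) *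
        (qp (q ^ 4) (q ^ 10) * qp (q ^ 9) (q ^ 10))) ^ 2 *
        (qp (-q ^ 4) (q ^ 10) * qp (-q ^ 6) (q ^ 10))) := by
    have h1 := qp_pow_five hq 1
    rw [pow_one] at h1
    rw [invNu, h1, qp_pow_five hq 2, qp_pow_five hq 3, qp_pow_five hq 4, pow_one]
  have hneg : invNu (-q) = (qp (q ^ 2) (q ^ 10) * qp (-q ^ 7) (q ^ 10) *
        (qp (-q ^ 3) (q ^ 10) * qp (q ^ 8) (q ^ 10))) ^ 2 *
        (qp (-q ^ 2) (q ^ 10) * qp (-q ^ 8) (q ^ 10)) /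
      ((qp (-q ^ 1) (q ^ 10) * qp (q ^ 6) (q ^ 10) *
        (qp (q ^ 4) (q ^ 10) * qp (-q ^ 9) (q ^ 10))) ^ 2 *
        (qp (-q ^ 4) (q ^ 10) * qp (-q ^ 6) (q ^ 10))) := by
    have hq' : ‖-q‖ < 1 := by rwa [norm_neg]
    have h1 := qp_pow_five hq' 1
    rw [pow_one] at h1
    rw [invNu, h1, qp_pow_five hq' 2, qp_pow_five hq' 3, qp_pow_five hq' 4]
    simp only [(by decide : Even 10).neg_pow, (by decide : Even 2).neg_pow,
      (by decide : Even 4).neg_pow, (by decide : Even 6).neg_pow, (by decide : Even 8).neg_pow,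
      (by decide : Odd 3).neg_pow, (by decide : Odd 7).neg_pow, (by decide : Odd 9).neg_pow,
      pow_one, Nat.reduceAdd]
  have hq10 : ‖q ^ 10‖ < 1 := norm_pow_lt_one hq (by norm_num)
  have hth := theta_sq_mul_theta_neg_sq_sub (pow_ne_zero 10 hq0) hq10
    (pow_ne_zero 1 hq0) (pow_ne_zero 3 hq0)
  rw [show q ^ 1 * q ^ 3 = q ^ 4 by ring, show q ^ 10 * q ^ 1 / q ^ 3 = q ^ 8 by field_simp,
    show q ^ 10 * q ^ 1 * q ^ 3 = q ^ 14 by ring,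
    show (q ^ 10) ^ 2 * q ^ 1 / q ^ 3 = q ^ 18 by field_simp, ← pow_mul,
    theta_pow (i := 1) (j := 9) hq0 (by norm_num), theta_pow (i := 3) (j := 7) hq0 (by norm_num),
    theta_neg_pow (i := 1) (j := 9) hq0 (by norm_num),
    theta_neg_pow (i := 3) (j := 7) hq0 (by norm_num),
    theta_pow (i := 4) (j := 16) hq0 (by norm_num), theta_pow (i := 8) (j := 12) hq0 (by norm_num),
    theta_pow (i := 14) (j := 6) hq0 (by norm_num),
    theta_pow (i := 18) (j := 2) hq0 (by norm_num)] at hth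
  have h1 := qp_pow_mul_qp_neg_pow hq 1
  have h2 := qp_pow_mul_qp_neg_pow hq 2
  have h4 := qp_pow_mul_qp_neg_pow hq 4
  have h6 := qp_pow_mul_qp_neg_pow hq 6
  have h8 := qp_pow_mul_qp_neg_pow hq 8
  have h9 := qp_pow_mul_qp_neg_pow hq 9
  have s2 := qp_pow_ten hq 2
  have s4 := qp_pow_ten hq 4
  have s6 := qp_pow_ten hq 6
  have s8 := qp_pow_ten hq 8
  simp only [Nat.reduceMul, Nat.reduceAdd] at hth h1 h2 h4 h6 h8 h9 s2 s4 s6 s8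
  have a1 := hne (m := 10) (i := 1) (by norm_num) (by norm_num)
  have a4 := hne (m := 10) (i := 4) (by norm_num) (by norm_num)
  have a6 := hne (m := 10) (i := 6) (by norm_num) (by norm_num)
  have a9 := hne (m := 10) (i := 9) (by norm_num) (by norm_num)
  have b1 := hne' (m := 10) (i := 1) (by norm_num) (by norm_num)
  have b4 := hne' (m := 10) (i := 4) (by norm_num) (by norm_num)
  have b6 := hne' (m := 10) (i := 6) (by norm_num) (by norm_num)
  have b9 := hne' (m := 10) (i := 9) (by norm_num) (by norm_num)
  have e10 := hne (m := 10) (i := 10) (by norm_num) (by norm_num)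
  have c2 := hne (m := 20) (i := 2) (by norm_num) (by norm_num)
  have c4 := hne (m := 20) (i := 4) (by norm_num) (by norm_num)
  have c6 := hne (m := 20) (i := 6) (by norm_num) (by norm_num)
  have c8 := hne (m := 20) (i := 8) (by norm_num) (by norm_num)
  have c12 := hne (m := 20) (i := 12) (by norm_num) (by norm_num)
  have c14 := hne (m := 20) (i := 14) (by norm_num) (by norm_num)
  have c16 := hne (m := 20) (i := 16) (by norm_num) (by norm_num)
  have c18 := hne (m := 20) (i := 18) (by norm_num) (by norm_num)
  rw [hpos, hneg, qp_pow_four_eq_prod hq]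
  rw [pow_one] at *
  generalize qp q (q ^ 10) = A1 at *
  generalize qp (-q) (q ^ 10) = B1 at *
  generalize qp (q ^ 2) (q ^ 10) = A2 at *
  generalize qp (-q ^ 2) (q ^ 10) = B2 at *
  generalize qp (q ^ 3) (q ^ 10) = A3 at *
  generalize qp (-q ^ 3) (q ^ 10) = B3 at *
  generalize qp (q ^ 4) (q ^ 10) = A4 at *
  generalize qp (-q ^ 4) (q ^ 10) = B4 at *
  generalize qp (q ^ 6) (q ^ 10) = A6 at *
  generalize qp (-q ^ 6) (q ^ 10) = B6 at *
  generalize qp (q ^ 7) (q ^ 10) = A7 at *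
  generalize qp (-q ^ 7) (q ^ 10) = B7 at *
  generalize qp (q ^ 8) (q ^ 10) = A8 at *
  generalize qp (-q ^ 8) (q ^ 10) = B8 at *
  generalize qp (q ^ 9) (q ^ 10) = A9 at *
  generalize qp (-q ^ 9) (q ^ 10) = B9 at *
  generalize qp (q ^ 10) (q ^ 10) = A10 at *
  generalize qp (q ^ 2) (q ^ 20) = C2 at *
  generalize qp (q ^ 4) (q ^ 20) = C4 at *
  generalize qp (q ^ 6) (q ^ 20) = C6 at *
  generalize qp (q ^ 8) (q ^ 20) = C8 at *
  generalize qp (q ^ 12) (q ^ 20) = C12 at *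
  generalize qp (q ^ 14) (q ^ 20) = C14 at *
  generalize qp (q ^ 16) (q ^ 20) = C16 at *
  generalize qp (q ^ 18) (q ^ 20) = C18 at *
  generalize qp (q ^ 20) (q ^ 20) = C20 at *
  have hL : (A2 * A8) ^ 2 * (B2 * B8) = C4 * C16 * (C2 * C12) * (C8 * C18) := by
    rw [← h2, ← h8, ← s2, ← s8]; ring
  have hR : (A4 * A6) ^ 2 * (B4 * B6) = C8 * C12 * (C4 * C14) * (C6 * C16) := by
    rw [← h4, ← h6, ← s4, ← s6]; ring
  have hX : (A3 * A7 * B1 * B9) ^ 2 - (B3 * B7 * A1 * A9) ^ 2 =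
      4 * q * (C4 * C16 * C8 * C12 * C14 * C6 * C18 * C2 * C20 ^ 4) / A10 ^ 4 := by
    rw [eq_div_iff (pow_ne_zero 4 e10)]
    linear_combination -hth
  calc _ = ((A2 * A8) ^ 2 * (B2 * B8)) * ((A3 * A7 * B1 * B9) ^ 2 - (B3 * B7 * A1 * A9) ^ 2) /
        (((A4 * A6) ^ 2 * (B4 * B6)) * (A1 * B1 * (A9 * B9)) ^ 2) := by field_simp
    _ = _ := by
      rw [hL, hR, hX, h1, h9]
      field_simp

/-- A power series vanishing on the unit disc has zero coefficients. -/
lemma eq_zero_of_hasSum_zero {c : ℕ → ℂ}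
    (h : ∀ q : ℂ, ‖q‖ < 1 → HasSum (fun n => c n * q ^ n) 0) (n : ℕ) : c n = 0 := by
  have hp : HasFPowerSeriesAt (0 : ℂ → ℂ) (FormalMultilinearSeries.ofScalars ℂ c) 0 := by
    rw [hasFPowerSeriesAt_iff]
    filter_upwards [Metric.ball_mem_nhds (0 : ℂ) one_pos] with z hz
    simpa [FormalMultilinearSeries.coeff_ofScalars, mul_comm] using
      h z (by simpa using hz)
  rw [← FormalMultilinearSeries.coeff_ofScalars (𝕜 := ℂ) (p := c) (n := n), hp.eq_zero]
  rfl

lemma thetaTerm_mul_root {ζ q : ℂ} (hζ : ζ ^ 5 = 1) (j : ℕ) (n : ℤ) :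
    (ζ ^ j) * thetaTerm ((ζ ^ j * q) ^ 12) ((ζ ^ j * q) ^ 4) n =
      (ζ ^ ((n - 1) ^ 2)) ^ j * thetaTerm (q ^ 12) (q ^ 4) n := by
  have hζ0 : ζ ≠ 0 := by rintro rfl; norm_num at hζ
  have hn := Int.two_mul_ediv_two_of_even (Int.even_mul_pred_self n)
  set t := n * (n - 1) / 2 with ht
  have key : ζ * (ζ ^ 12) ^ t * (ζ ^ 4) ^ n = ζ ^ ((n - 1) ^ 2) := by
    have h5 : (ζ ^ 5) ^ (2 * t + n) = 1 := by rw [hζ, one_zpow]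
    simp only [← zpow_natCast, ← zpow_mul] at h5 ⊢
    rw [show (n - 1) ^ 2 = 1 + (12 : ℕ) * t + (4 : ℕ) * n - (5 : ℕ) * (2 * t + n) by
      push_cast; linear_combination -hn, zpow_sub₀ hζ0, h5, zpow_add₀ hζ0, zpow_add₀ hζ0]
    simp
  have hj : (ζ ^ ((n - 1) ^ 2)) ^ j = ζ ^ j * ((ζ ^ j) ^ 12) ^ t * ((ζ ^ j) ^ 4) ^ n := by
    rw [← key, mul_pow, mul_pow]
    simp only [← zpow_natCast, ← zpow_mul]
    congr 2 <;> ring_nf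
  rw [hj, thetaTerm, thetaTerm, ← ht, mul_pow _ q, mul_pow _ q, mul_zpow, mul_zpow]
  ring

lemma sum_pow_eq_zero {ω : ℂ} (h5 : ω ^ 5 = 1) (h1 : ω ≠ 1) : ∑ j ∈ Finset.range 5, ω ^ j = 0 := by
  rw [geom_sum_eq h1, h5, sub_self, zero_div]

lemma zpow_pow_five {ζ : ℂ} (hζ : ζ ^ 5 = 1) (k : ℤ) : (ζ ^ k) ^ 5 = 1 := by
  rw [← zpow_natCast, zpow_comm, zpow_natCast, hζ, one_zpow]

lemma sum_root_mul_invNu {ζ q : ℂ} (hζ : IsPrimitiveRoot ζ 5) (hq : ‖q‖ < 1) {s : ℕ}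
    (hs : s = 2 ∨ s = 3) :
    ∑ j ∈ Finset.range 5, (ζ ^ s) ^ j * (invNu (ζ ^ j * q) - invNu (-(ζ ^ j * q))) = 0 := by
  rcases eq_or_ne q 0 with rfl | hq0
  · simp
  have h5 := hζ.pow_eq_one
  have hζ0 : ζ ≠ 0 := hζ.ne_zero (by norm_num)
  have hζn : ‖ζ‖ = 1 := Complex.norm_eq_one_of_pow_eq_one h5 (by norm_num)
  have hmul (j : ℕ) {m : ℕ} (hm : 5 ∣ m) : (ζ ^ j * q) ^ m = q ^ m := by
    obtain ⟨k, rfl⟩ := hm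
    rw [mul_pow, ← pow_mul, mul_comm j, pow_mul, pow_mul, h5, one_pow, one_pow, one_mul]
  set K := qp (q ^ 20) (q ^ 20) ^ 3 / qp (q ^ 10) (q ^ 10) ^ 4
  have hterm (j : ℕ) : HasSum
      (fun n => (ζ ^ s) ^ j * (4 * q * K * ((ζ ^ ((n - 1) ^ 2)) ^ j * thetaTerm (q ^ 12) (q ^ 4) n)))
      ((ζ ^ s) ^ j * (invNu (ζ ^ j * q) - invNu (-(ζ ^ j * q)))) := by
    have hne : ζ ^ j * q ≠ 0 := mul_ne_zero (pow_ne_zero _ hζ0) hq0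
    have hlt : ‖ζ ^ j * q‖ < 1 := by simpa [hζn] using hq
    have h := (summable_thetaTerm (pow_ne_zero 12 hne) (norm_pow_lt_one hlt (by norm_num))
      (pow_ne_zero 4 hne)).hasSum
    rw [← theta_eq_tsum (pow_ne_zero 12 hne) (norm_pow_lt_one hlt (by norm_num))
      (pow_ne_zero 4 hne), ← qp_pow_four_eq_theta hne hlt] at h
    have h' := (h.mul_left (4 * q * K * ζ ^ j)).mul_left ((ζ ^ s) ^ j)
    rw [invNu_sub_invNu_neg hne hlt, hmul j (m := 20) (by norm_num),
      hmul j (m := 10) (by norm_num)]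
    convert h' using 1
    · rfl
    · ext n
      rw [← thetaTerm_mul_root h5]
      ring
    · ring
  refine (hasSum_sum fun j (_ : j ∈ Finset.range 5) => hterm j).unique ?_
  convert hasSum_zero using 1
  ext n
  have hω : ζ ^ (s + (n - 1) ^ 2) ≠ 1 := by
    rw [Ne, hζ.zpow_eq_one_iff_dvd]
    intro hd
    have hz := (ZMod.intCast_zmod_eq_zero_iff_dvd _ 5).mpr hd
    have hdec : ∀ x : ZMod 5, 2 + (x - 1) ^ 2 ≠ 0 ∧ 3 + (x - 1) ^ 2 ≠ 0 := by decide
    rcases hs with rfl | rfl <;> push_cast at hz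
    · exact (hdec n).1 hz
    · exact (hdec n).2 hz
  have h0 := sum_pow_eq_zero (zpow_pow_five h5 _) hω
  calc _ = (∑ j ∈ Finset.range 5, (ζ ^ (s + (n - 1) ^ 2)) ^ j) *
        (4 * q * K * thetaTerm (q ^ 12) (q ^ 4) n) := by
        rw [Finset.sum_mul]
        refine Finset.sum_congr rfl fun j _ => ?_
        rw [zpow_add₀ hζ0, zpow_natCast, mul_pow]
        ring
    _ = 0 := by rw [h0, zero_mul]

lemma coeff_eq_zero {β : ℕ → ℂ}
    (hβ : ∀ q : ℂ, ‖q‖ < 1 → HasSum (fun n => β n * q ^ n) (invNu q))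
    {s n : ℕ} (hs : s = 2 ∨ s = 3) (hn : Odd n) (hsn : 5 ∣ n + s) : β n = 0 := by
  obtain ⟨ζ, hζ⟩ : ∃ ζ : ℂ, IsPrimitiveRoot ζ 5 := ⟨_, Complex.isPrimitiveRoot_exp 5 (by norm_num)⟩
  have hζn : ‖ζ‖ = 1 := Complex.norm_eq_one_of_pow_eq_one hζ.pow_eq_one (by norm_num)
  have h := eq_zero_of_hasSum_zero
    (c := fun n => (∑ j ∈ Finset.range 5, (ζ ^ (n + s)) ^ j) * (1 - (-1) ^ n) * β n) (fun q hq => by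
      rw [← sum_root_mul_invNu hζ hq hs]
      have hlt (j : ℕ) : ‖ζ ^ j * q‖ < 1 := by simpa [hζn] using hq
      have h1 := hasSum_sum fun j (_ : j ∈ Finset.range 5) => ((hβ _ (hlt j)).sub
        (hβ (-(ζ ^ j * q)) (by rw [norm_neg]; exact hlt j))).mul_left ((ζ ^ s) ^ j)
      convert h1 using 1
      · rfl
      · ext m
        simp only [Finset.sum_mul]
        refine Finset.sum_congr rfl fun j _ => ?_
        rw [neg_pow (ζ ^ j * q), mul_pow, ← pow_mul, ← pow_mul, ← pow_mul]
        ring) n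
  obtain ⟨k, hk⟩ := hsn
  have h5 : ζ ^ (n + s) = 1 := by rw [hk, pow_mul, hζ.pow_eq_one, one_pow]
  simp only [h5, hn.neg_one_pow] at h
  norm_num at h
  exact h

theorem stmt_17 : ∀ β : ℕ → ℂ,
    (∀ q : ℂ, ‖q‖ < 1 →
      HasSum (fun n : ℕ => β n * q ^ n)
        ((qp (q ^ 2) (q ^ 5) * qp (q ^ 3) (q ^ 5)) ^ 2 * (qp (-(q ^ 2)) (q ^ 10) * qp (-(q ^ 8)) (q ^ 10)) /
          ((qp q (q ^ 5) * qp (q ^ 4) (q ^ 5)) ^ 2 * (qp (-(q ^ 4)) (q ^ 10) * qp (-(q ^ 6)) (q ^ 10))))) →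
    ∀ n : ℕ, β (10 * n + 3) = 0 ∧ β (10 * n + 7) = 0 := by
  intro β hβ n
  exact ⟨coeff_eq_zero hβ (.inl rfl) ⟨5 * n + 1, by ring⟩ ⟨2 * n + 1, by ring⟩,
    coeff_eq_zero hβ (.inr rfl) ⟨5 * n + 3, by ring⟩ ⟨2 * n + 2, by ring⟩⟩
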